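/- For every integer k ≥ 1, every real T > 0, and every z with |z| < 1, the fugal function satisfies r_k(T, Tz) ≥ T · a_k(z); in particular, for k ≥ 2, r_k(T, 0) ≥ T/√(2k). -/

import Mathlib

/-- The fugal functions `r_k(T, Z)` (for `k ≥ 1`; the value at `k = 0` is junk), defined
recursively by
`r₁(T,Z) = inf_{x∈[−1,1]} max_{w∈{−1,1}} ( T w x + |Z + T w| )` and
`r_{k+1}(T,Z) = inf_{x∈[−1,1]} max_{w∈{−1,1}} inf_{t∈[0,T]} ( t w x + r_k(T−t, Z+tw) )`,
where the maximum over `w ∈ {−1,1}` is written out explicitly with its two values. -/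
noncomputable def fugal : ℕ → ℝ → ℝ → ℝ
  | 0 => fun _ Z => |Z|
  | 1 => fun T Z =>
      sInf ((fun x : ℝ => max (T * x + |Z + T|) (-(T * x) + |Z - T|)) ''
        Set.Icc (-1 : ℝ) 1)
  | k + 2 => fun T Z =>
      sInf ((fun x : ℝ =>
        max (sInf ((fun t : ℝ => t * x + fugal (k + 1) (T - t) (Z + t)) '' Set.Icc 0 T))
            (sInf ((fun t : ℝ => -(t * x) + fugal (k + 1) (T - t) (Z - t)) ''
              Set.Icc 0 T))) '' Set.Icc (-1 : ℝ) 1)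

/-- The quadratic lower bound functions `a_k` on `[−1,1]`: `a₁(z) = 1` and, for `i ≥ 2`,
`a_i(z) = (√(i/2)·z² + √(2/i))/2` if `|z| < √(2/i)` and `a_i(z) = |z|` otherwise. -/
noncomputable def aQuad (i : ℕ) (z : ℝ) : ℝ :=
  if i ≤ 1 then 1
  else if |z| < Real.sqrt (2 / (i : ℝ)) then
    (Real.sqrt ((i : ℝ) / 2) * z ^ 2 + Real.sqrt (2 / (i : ℝ))) / 2
  else |z|

/-- To bound `fugal (k + 2) T Z` from below by `b`, it suffices to exhibit a slope `g`: the choice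
of sign `w` is then dictated by whether `-g ≤ x`. -/
lemma le_fugal_add_two {k : ℕ} {T Z b : ℝ} (hT : 0 ≤ T) (g : ℝ)
    (hpos : ∀ t, 0 ≤ t → t ≤ T → b ≤ -(t * g) + fugal (k + 1) (T - t) (Z + t))
    (hneg : ∀ t, 0 ≤ t → t ≤ T → b ≤ t * g + fugal (k + 1) (T - t) (Z - t)) :
    b ≤ fugal (k + 2) T Z := by
  have hne : (Set.Icc 0 T).Nonempty := ⟨0, le_rfl, hT⟩
  rw [fugal]
  refine le_csInf ⟨_, 0, by norm_num, rfl⟩ ?_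
  rintro _ ⟨x, -, rfl⟩
  rcases le_total (-g) x with h | h
  · refine le_max_of_le_left (le_csInf (hne.image _) ?_)
    rintro _ ⟨t, ⟨h0, h1⟩, rfl⟩
    have := mul_le_mul_of_nonneg_left h h0
    have := hpos t h0 h1
    simp only
    linarith
  · refine le_max_of_le_right (le_csInf (hne.image _) ?_)
    rintro _ ⟨t, ⟨h0, h1⟩, rfl⟩
    have := mul_le_mul_of_nonneg_left h h0
    have := hneg t h0 h1
    simp only
    linarith

lemma le_fugal_one {T Z b : ℝ} (hb : 2 * b ≤ |Z + T| + |Z - T|) : b ≤ fugal 1 T Z := by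
  rw [fugal]
  refine le_csInf ⟨_, 0, by norm_num, rfl⟩ ?_
  rintro _ ⟨x, -, rfl⟩
  simp only
  rcases le_total (T * x + |Z + T|) (-(T * x) + |Z - T|) with h | h
  · rw [max_eq_right h]; linarith
  · rw [max_eq_left h]; linarith

lemma self_le_fugal_one (T Z : ℝ) : T ≤ fugal 1 T Z :=
  le_fugal_one (by linarith [le_abs_self (Z + T), neg_abs_le (Z - T)])

lemma abs_le_fugal (k : ℕ) {T : ℝ} (hT : 0 ≤ T) (Z : ℝ) : |Z| ≤ fugal (k + 1) T Z := by
  induction k generalizing T Z with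
  | zero =>
    refine le_fugal_one ?_
    calc 2 * |Z| = |(Z + T) + (Z - T)| := by
          rw [show (Z + T) + (Z - T) = 2 * Z by ring, abs_mul, abs_two]
      _ ≤ _ := abs_add_le _ _
  | succ k ih =>
    rcases le_total 0 Z with hZ | hZ
    · rw [abs_of_nonneg hZ]
      refine le_fugal_add_two hT 1 (fun t _ h1 => ?_) (fun t _ h1 => ?_)
      · linarith [ih (sub_nonneg.2 h1) (Z + t), le_abs_self (Z + t)]
      · linarith [ih (sub_nonneg.2 h1) (Z - t), le_abs_self (Z - t)]
    · rw [abs_of_nonpos hZ]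
      refine le_fugal_add_two hT (-1) (fun t _ h1 => ?_) (fun t _ h1 => ?_)
      · linarith [ih (sub_nonneg.2 h1) (Z + t), neg_abs_le (Z + t)]
      · linarith [ih (sub_nonneg.2 h1) (Z - t), neg_abs_le (Z - t)]

/-- `f` dominates the convex homogeneous function equal to `(c Z² / T + T / c) / 2` on the cone
`c |Z| ≤ T` and to `|Z|` outside it, expressed through its supporting linear forms. -/
def DominatesQuad (c : ℝ) (f : ℝ → ℝ → ℝ) : Prop :=
  ∀ T Z p : ℝ, 0 ≤ T → |p| ≤ 1 → p * Z + (1 - p ^ 2) * T / (2 * c) ≤ f T Z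

lemma dominatesQuad_of_cone {c : ℝ} (hc : 0 < c) {f : ℝ → ℝ → ℝ}
    (habs : ∀ T Z : ℝ, 0 ≤ T → |Z| ≤ f T Z)
    (hcone : ∀ T z : ℝ, 0 < T → c * |z| ≤ 1 → T * ((c * z ^ 2 + 1 / c) / 2) ≤ f T (T * z)) :
    DominatesQuad c f := by
  intro T Z p hT hp
  by_cases h : 0 < T ∧ c * |Z / T| ≤ 1
  · obtain ⟨hT0, hz⟩ := h
    have key := hcone T (Z / T) hT0 hz
    rw [mul_div_cancel₀ _ hT0.ne'] at key
    refine le_trans ?_ key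
    have hsq : T * ((c * (Z / T) ^ 2 + 1 / c) / 2) - (p * Z + (1 - p ^ 2) * T / (2 * c))
        = T / (2 * c) * (c * (Z / T) - p) ^ 2 := by
      field_simp
      ring
    have : 0 ≤ T / (2 * c) * (c * (Z / T) - p) ^ 2 := by positivity
    linarith
  · refine le_trans ?_ (habs T Z hT)
    have hTZ : T / c ≤ |Z| := by
      rw [div_le_iff₀ hc]
      rcases hT.eq_or_lt with rfl | hT0
      · positivity
      · have h' : 1 < c * |Z / T| := not_le.1 fun h' => h ⟨hT0, h'⟩
        rw [abs_div, abs_of_pos hT0, ← mul_div_assoc, lt_div_iff₀ hT0] at h'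
        linarith
    have hpZ : p * Z ≤ |p| * |Z| := by rw [← abs_mul]; exact le_abs_self _
    have hTc : 0 ≤ T / c := by positivity
    have hsplit : (1 - p ^ 2) * T / (2 * c) = (1 - |p|) * ((1 + |p|) / 2 * (T / c)) := by
      rw [← sq_abs p]
      field_simp
      ring
    have hhalf : (1 + |p|) / 2 * (T / c) ≤ |Z| := by nlinarith
    have := mul_le_mul_of_nonneg_left hhalf (sub_nonneg.2 hp)
    rw [hsplit]
    linarith

lemma dominatesQuad_fugal_two : DominatesQuad 1 (fugal 2) := by
  refine dominatesQuad_of_cone one_pos (fun T Z hT => abs_le_fugal 1 hT Z) ?_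
  intro T z hT hz
  obtain ⟨hz1, hz2⟩ := abs_le.1 (by linarith : |z| ≤ 1)
  refine le_fugal_add_two hT.le z (fun t _ h1 => ?_) (fun t _ h1 => ?_)
  · have hA := self_le_fugal_one (T - t) (T * z + t)
    have hB := (le_abs_self _).trans (abs_le_fugal 0 (sub_nonneg.2 h1) (T * z + t))
    norm_num at hA hB ⊢
    nlinarith
  · have hA := self_le_fugal_one (T - t) (T * z - t)
    have hB := (neg_le_abs _).trans (abs_le_fugal 0 (sub_nonneg.2 h1) (T * z - t))
    norm_num at hA hB ⊢
    nlinarith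

/-- In the variable `s`, the left side is affine and the right side concave; so the inequality
reduces to the endpoints `s = 0` and `s = 1 / C ^ 2`. -/
lemma affine_le_sqrt {c C s : ℝ} (hc : 1 ≤ c) (hC : 0 < C) (hcC : C ^ 2 = c ^ 2 + 1 / 2)
    (hs : 0 ≤ s) (hsC : s * C ^ 2 ≤ 1) :
    c * (1 - s) + (C * s + 1 / C) / 2 ≤ √(c ^ 2 + 1 - c ^ 2 * s) := by
  obtain ⟨r, hr⟩ : ∃ r, r = 1 / C := ⟨_, rfl⟩
  obtain ⟨θ, hθ⟩ : ∃ θ, θ = s * C ^ 2 := ⟨_, rfl⟩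
  have hr0 : 0 < r := by rw [hr]; positivity
  have hrC : r * C = 1 := by rw [hr]; field_simp
  have hrc : r ^ 2 * (c ^ 2 + 1 / 2) = 1 := by rw [← hcC, ← mul_pow, hrC, one_pow]
  have hsθ : s = θ * r ^ 2 := by rw [hθ, mul_assoc, ← mul_pow, mul_comm C, hrC]; ring
  have hθ0 : 0 ≤ θ := by rw [hθ]; positivity
  have hθ1 : θ ≤ 1 := hθ ▸ hsC
  have hr1 : r ^ 2 ≤ 1 := by nlinarith
  have hlin : c * (1 - s) + (C * s + 1 / C) / 2
      = (1 - θ) * (c + r / 2) + θ * (c * (1 - r ^ 2) + r) := by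
    have : C * s = θ * r := by rw [hsθ]; linear_combination θ * r * hrC
    rw [this, ← hr, hsθ]
    ring
  have hA : (c + r / 2) ^ 2 ≤ c ^ 2 + 1 := by
    have : c * r ≤ 1 - r ^ 2 / 4 := by
      apply le_of_sq_le_sq _ (by linarith)
      nlinarith [sq_nonneg (r ^ 2)]
    nlinarith
  have hB : (c * (1 - r ^ 2) + r) ^ 2 ≤ c ^ 2 + 1 - c ^ 2 * r ^ 2 := by
    have h := mul_nonneg (sub_nonneg.2 hr1) (sq_nonneg (1 - c * r))
    linarith
  apply Real.le_sqrt_of_sq_le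
  rw [hlin, hsθ]
  nlinarith [mul_le_mul_of_nonneg_left hA (sub_nonneg.2 hθ1), mul_le_mul_of_nonneg_left hB hθ0,
    mul_nonneg (mul_nonneg hθ0 (sub_nonneg.2 hθ1))
      (sq_nonneg ((c + r / 2) - (c * (1 - r ^ 2) + r)))]

lemma DominatesQuad.fugal_succ {k : ℕ} {c C : ℝ} (hc : 1 ≤ c) (hC : 0 < C)
    (hcC : C ^ 2 = c ^ 2 + 1 / 2) (h : DominatesQuad c (fugal (k + 1))) :
    DominatesQuad C (fugal (k + 2)) := by
  refine dominatesQuad_of_cone hC (fun T Z hT => abs_le_fugal (k + 1) hT Z) ?_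
  intro T z hT hz
  have hc0 : 0 < c := by linarith
  have hcC' : c ≤ C := by nlinarith
  have hsC : z ^ 2 * C ^ 2 ≤ 1 := by
    have := pow_le_pow_left₀ (by positivity) hz 2
    rw [mul_pow, sq_abs] at this
    linarith
  have key := affine_le_sqrt hc hC hcC (sq_nonneg z) hsC
  obtain ⟨d, hd⟩ : ∃ d, d = √(c ^ 2 + 1 - c ^ 2 * z ^ 2) - c := ⟨_, rfl⟩
  obtain ⟨m, hm⟩ : ∃ m, m = c * z := ⟨_, rfl⟩
  have hm1 : |m| ≤ 1 := by
    rw [hm, abs_mul, abs_of_pos hc0]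
    exact (mul_le_mul_of_nonneg_right hcC' (abs_nonneg z)).trans hz
  obtain ⟨hm_lo, hm_hi⟩ := abs_le.1 hm1
  have hm2 : m ^ 2 ≤ 1 := by nlinarith
  have hroot : (d + c) ^ 2 = c ^ 2 + 1 - m ^ 2 := by
    rw [hd, sub_add_cancel, Real.sq_sqrt, hm, mul_pow]
    rw [← mul_pow, ← hm]
    nlinarith
  have hdc : 0 ≤ d + c := by rw [hd, sub_add_cancel]; positivity
  have hd0 : 0 ≤ d := by nlinarith
  have hd_le : d ≤ 1 - m := by
    have : d + c ≤ 1 - m + c := abs_le_of_sq_le_sq' (by nlinarith) (by linarith) |>.2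
    linarith
  have hd_le' : d ≤ 1 + m := by
    have : d + c ≤ 1 + m + c := abs_le_of_sq_le_sq' (by nlinarith) (by linarith) |>.2
    linarith
  have hz_eq : z = m / c := by rw [hm]; field_simp
  have hval : (C * z ^ 2 + 1 / C) / 2 ≤ m * z + d := by
    rw [hd, hm]
    linarith
  have hvalT := mul_le_mul_of_nonneg_left hval hT.le
  refine le_fugal_add_two hT.le (m + d - (1 - (m + d) ^ 2) / (2 * c))
    (fun t _ h1 => ?_) (fun t _ h1 => ?_)
  · have hf := h (T - t) (T * z + t) (m + d) (sub_nonneg.2 h1)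
      (abs_le.2 ⟨by linarith, by linarith⟩)
    have heq : T * (m * z + d) = -(t * (m + d - (1 - (m + d) ^ 2) / (2 * c)))
        + ((m + d) * (T * z + t) + (1 - (m + d) ^ 2) * (T - t) / (2 * c)) := by
      rw [hz_eq]
      field_simp
      linear_combination T * hroot
    linarith
  · have hf := h (T - t) (T * z - t) (m - d) (sub_nonneg.2 h1)
      (abs_le.2 ⟨by linarith, by linarith⟩)
    have heq : T * (m * z + d) = t * (m + d - (1 - (m + d) ^ 2) / (2 * c))
        + ((m - d) * (T * z - t) + (1 - (m - d) ^ 2) * (T - t) / (2 * c)) := by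
      rw [hz_eq]
      field_simp
      linear_combination (T - 2 * t) * hroot
    linarith

lemma dominatesQuad_fugal (k : ℕ) (hk : 2 ≤ k) : DominatesQuad √((k : ℝ) / 2) (fugal k) := by
  induction k, hk using Nat.le_induction with
  | base => simpa using dominatesQuad_fugal_two
  | succ k hk ih =>
    obtain ⟨j, rfl⟩ : ∃ j, k = j + 1 := ⟨k - 1, by omega⟩
    have hk' : (2 : ℝ) ≤ ((j + 1 : ℕ) : ℝ) := by exact_mod_cast hk
    refine ih.fugal_succ (Real.one_le_sqrt.2 (by linarith)) (Real.sqrt_pos.2 (by positivity)) ?_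
    rw [Real.sq_sqrt (by positivity), Real.sq_sqrt (by positivity)]
    push_cast
    ring

/-- For every integer `k ≥ 1`, every real `T > 0`, and every `z` with `|z| < 1`, the
fugal function satisfies `r_k(T, Tz) ≥ T · a_k(z)`; in particular, for `k ≥ 2`,
`r_k(T, 0) ≥ T/√(2k)`. -/
theorem stmt17 (k : ℕ) (hk : 1 ≤ k) (T : ℝ) (hT : 0 < T) :
    (∀ z : ℝ, |z| < 1 → T * aQuad k z ≤ fugal k T (T * z)) ∧
    (2 ≤ k → T / Real.sqrt (2 * k) ≤ fugal k T 0) := by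
  have hc0 : 0 < √((k : ℝ) / 2) := Real.sqrt_pos.2 (by positivity)
  refine ⟨fun z _ => ?_, fun hk2 => ?_⟩
  · rw [aQuad]
    split_ifs with h1 h2
    · obtain rfl : k = 1 := by omega
      simpa using self_le_fugal_one T (T * z)
    · have hinv : √(2 / (k : ℝ)) = 1 / √((k : ℝ) / 2) := by
        rw [one_div, ← Real.sqrt_inv, inv_div]
      rw [hinv] at h2 ⊢
      rw [lt_div_iff₀ hc0] at h2
      refine le_trans (le_of_eq ?_) (dominatesQuad_fugal k (by omega) T (T * z)
        (√((k : ℝ) / 2) * z) hT.le ?_)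
      · field_simp
        ring
      · rw [abs_mul, abs_of_pos hc0]
        linarith
    · obtain ⟨j, rfl⟩ : ∃ j, k = j + 1 := ⟨k - 1, by omega⟩
      have := abs_le_fugal j hT.le (T * z)
      rwa [abs_mul, abs_of_pos hT] at this
  · have h := dominatesQuad_fugal k hk2 T 0 0 hT.le (by simp)
    have h2 : √(2 * (k : ℝ)) = 2 * √((k : ℝ) / 2) := by
      rw [show 2 * (k : ℝ) = 2 ^ 2 * (k / 2) by ring, Real.sqrt_mul (by norm_num),
        Real.sqrt_sq (by norm_num)]
    rw [h2]
    simpa using h
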